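/- Let a ≠ 0, b, c ∈ ℝ, l > 0, T > 0. The L²((0,T), L²((0,l)))-norm of a classical solution v of v_t = a² v_xx + b v_x + c v + g on (0,l) × (0,T), with v(0,t) = θ₁(t), v(l,t) = θ₂(t), v(x,0) = ψ(x), depends continuously on the data: there exists a constant C > 0, independent of the data, such that ‖v‖_{L²((0,T),L²((0,l)))} ≤ C ‖(g, ψ, θ₁, θ₂)‖ where the data norm is taken in L²((0,T), L²((0,l))) × L²((0,l)) × W^{1,2}((0,T)) × W^{1,2}((0,T)). -/

import Mathlib

open Set Filter Topology intervalIntegral Real MeasureTheory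

noncomputable section

/-- Classical solution of `v_t = a² v_xx + b v_x + c v + g` on `(0,l) × (0,T)` with
`v(0,t) = θ₁(t)`, `v(l,t) = θ₂(t)` and `v(x,0) = ψ(x)`. -/
def IsClassicalSolution (a b c l T : ℝ) (g : ℝ → ℝ → ℝ) (θ₁ θ₂ ψ : ℝ → ℝ)
    (v : ℝ → ℝ → ℝ) : Prop :=
  ContinuousOn (fun p : ℝ × ℝ => v p.1 p.2) (Set.Icc 0 l ×ˢ Set.Icc 0 T) ∧
  ContinuousOn (fun p : ℝ × ℝ => deriv (fun s => v p.1 s) p.2) (Set.Icc 0 l ×ˢ Set.Icc 0 T) ∧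
  ContinuousOn (fun p : ℝ × ℝ => deriv (fun y => deriv (fun z => v z p.2) y) p.1)
    (Set.Icc 0 l ×ˢ Set.Icc 0 T) ∧
  (∀ x ∈ Set.Ioo 0 l, ∀ t ∈ Set.Ioo 0 T,
    DifferentiableAt ℝ (fun s => v x s) t ∧
    DifferentiableAt ℝ (fun y => v y t) x ∧
    DifferentiableAt ℝ (fun y => deriv (fun z => v z t) y) x) ∧
  (∀ x ∈ Set.Ioo 0 l, ∀ t ∈ Set.Ioo 0 T,
    deriv (fun s => v x s) t =
      a ^ 2 * deriv (fun y => deriv (fun z => v z t) y) x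
        + b * deriv (fun y => v y t) x + c * v x t + g x t) ∧
  (∀ t ∈ Set.Ioo 0 T, v 0 t = θ₁ t ∧ v l t = θ₂ t) ∧
  (∀ x ∈ Set.Ioo 0 l, v x 0 = ψ x)

lemma aux_integrable {l M : ℝ} (hl : 0 < l) {f : ℝ → ℝ} (hf : ContinuousOn f (Ioo 0 l))
    (hM : ∀ x ∈ Ioo 0 l, |f x| ≤ M) : IntervalIntegrable f volume 0 l := by
  rw [intervalIntegrable_iff_integrableOn_Ioo_of_le hl.le]
  have hm : AEStronglyMeasurable f (volume.restrict (Ioo 0 l)) :=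
    hf.aestronglyMeasurable measurableSet_Ioo
  refine Integrable.mono' (g := fun _ => M) ?_ hm ?_
  · exact integrableOn_const (by simp) (by simp)
  · exact (ae_restrict_iff' measurableSet_Ioo).2 (Eventually.of_forall fun x hx => hM x hx)

lemma aux_sq {f : ℝ → ℝ} {f' x : ℝ} (h : HasDerivAt f f' x) :
    HasDerivAt (fun y => f y ^ 2) (2 * f x * f') x := by
  have h2 := HasDerivAt.mul h h
  have e1 : (fun y => f y ^ 2) = f * f := by funext y; simp [sq]
  rw [e1]
  have e2 : 2 * f x * f' = f' * f x + f x * f' := by ring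
  rw [e2]; exact h2

lemma aux_slice {a b c l K ρ : ℝ} (hl : 0 < l) (hK : 2 * c + 1 ≤ K)
    {u d e ut g k : ℝ → ℝ} (hu : ContinuousOn u (Icc 0 l)) (hu0 : u 0 = 0) (hul : u l = 0)
    (hd : ∀ x ∈ Ioo 0 l, HasDerivAt u (d x) x) (he : ∀ x ∈ Ioo 0 l, HasDerivAt d (e x) x)
    (hec : ContinuousOn e (Icc 0 l)) (hut : ContinuousOn ut (Icc 0 l))
    (hk : ContinuousOn k (Icc 0 l)) (hg : ∀ x ∈ Ioo 0 l, g x = k x - b * d x)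
    (hs : ∀ x ∈ Ioo 0 l, (ut x - a ^ 2 * e x - b * d x - c * u x) ^ 2 ≤ 4 * g x ^ 2 + ρ) :
    ∫ x in (0:ℝ)..l, 2 * u x * ut x ≤
      K * (∫ x in (0:ℝ)..l, u x ^ 2) + 4 * (∫ x in (0:ℝ)..l, g x ^ 2) + l * ρ := by
  have hsub : Ioo 0 l ⊆ Icc 0 l := Ioo_subset_Icc_self
  obtain ⟨M, hM⟩ := isCompact_Icc.exists_bound_of_continuousOn hec
  obtain ⟨Mu, hMu⟩ := isCompact_Icc.exists_bound_of_continuousOn hu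
  obtain ⟨Mk, hMk⟩ := isCompact_Icc.exists_bound_of_continuousOn hk
  have hM0 : 0 ≤ M := (norm_nonneg _).trans (hM 0 ⟨le_rfl, hl.le⟩)
  have hmid : l / 2 ∈ Ioo 0 l := ⟨by linarith, by linarith⟩
  have hdc : ContinuousOn d (Ioo 0 l) := fun x hx => (he x hx).continuousAt.continuousWithinAt
  obtain ⟨D, hD⟩ : ∃ D, ∀ x ∈ Ioo 0 l, |d x| ≤ D := by
    refine ⟨|d (l/2)| + M * l, fun x hx => ?_⟩
    have h := Convex.norm_image_sub_le_of_norm_hasDerivWithin_le (f := d) (f' := e) (C := M)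
      (fun y hy => (he y hy).hasDerivWithinAt) (fun y hy => hM y (hsub hy)) (convex_Ioo 0 l) hmid hx
    simp only [Real.norm_eq_abs] at h
    have h2 : |x - l / 2| ≤ l := by rw [abs_le]; constructor <;> linarith [hx.1, hx.2]
    have h3 := abs_sub_abs_le_abs_sub (d x) (d (l/2))
    have h4 := mul_le_mul_of_nonneg_left h2 hM0
    linarith
  have hdi : IntervalIntegrable d volume 0 l := aux_integrable hl hdc hD
  have hui : uIcc 0 l = Icc 0 l := uIcc_of_le hl.le
  have hi1 : IntervalIntegrable (fun x => u x * (a ^ 2 * e x + b * d x)) volume 0 l := by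
    have h1 : IntervalIntegrable (fun x => a ^ 2 * e x + b * d x) volume 0 l := by
      refine IntervalIntegrable.add ?_ (hdi.const_mul b)
      exact ((continuousOn_const.mul hec).intervalIntegrable_of_Icc hl.le)
    exact h1.continuousOn_mul (hui ▸ hu)
  have key : ∫ x in (0:ℝ)..l, u x * (a ^ 2 * e x + b * d x) ≤ 0 := by
    have hΦ : ContinuousOn (fun x => a ^ 2 * (d x * u x) + b / 2 * u x ^ 2) (Icc 0 l) := by
      have hdu : ContinuousOn (fun x => d x * u x) (Icc 0 l) := by
        intro x hx
        by_cases hx' : x ∈ Ioo 0 l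
        · exact ((he x hx').continuousAt.continuousWithinAt).mul (hu x hx)
        · have hux : u x = 0 := by
            rcases eq_or_lt_of_le hx.1 with h | h
            · rw [← h, hu0]
            · rcases eq_or_lt_of_le hx.2 with h2 | h2
              · rw [h2, hul]
              · exact absurd ⟨h, h2⟩ hx'
          have h1 : Tendsto u (𝓝[Icc 0 l] x) (𝓝 0) := hux ▸ hu x hx
          have h2 : ∀ᶠ y in 𝓝[Icc 0 l] x, |d y| ≤ max D (max |d 0| |d l|) := by
            filter_upwards [self_mem_nhdsWithin] with y hy
            rcases eq_or_lt_of_le hy.1 with h | h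
            · rw [← h]; simp
            · rcases eq_or_lt_of_le hy.2 with h2 | h2
              · rw [h2]; simp
              · exact (hD y ⟨h, h2⟩).trans (le_max_left _ _)
          have h3 := bdd_le_mul_tendsto_zero' _ h2 h1
          simpa [ContinuousWithinAt, hux] using h3
      exact (continuousOn_const.mul hdu).add (continuousOn_const.mul (hu.pow 2))
    have := intervalIntegral.integral_le_sub_of_hasDeriv_right_of_le (a := 0) (b := l)
      (g := fun x => a ^ 2 * (d x * u x) + b / 2 * u x ^ 2)
      (g' := fun x => a ^ 2 * (e x * u x + d x * d x) + b / 2 * (2 * u x * d x))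
      (φ := fun x => u x * (a ^ 2 * e x + b * d x)) hl.le hΦ
      (fun x hx => by
        have h1 := ((he x hx).mul (hd x hx)).const_mul (a ^ 2)
        have h2 := (aux_sq (hd x hx)).const_mul (b / 2)
        have h3 := (h1.add h2).hasDerivWithinAt (s := Ioi x)
        exact h3)
      ((intervalIntegrable_iff_integrableOn_Icc_of_le hl.le).1 hi1)
      (fun x hx => by
        have : 0 ≤ a ^ 2 * (d x * d x) := mul_nonneg (sq_nonneg _) (mul_self_nonneg _)
        nlinarith)
    simpa [hu0, hul] using this
  have hgi : IntervalIntegrable (fun x => g x ^ 2) volume 0 l := by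
    have hgc : ContinuousOn g (Ioo 0 l) :=
      ((hk.mono hsub).sub (continuousOn_const.mul hdc)).congr hg
    refine aux_integrable (M := (Mk + |b| * D) ^ 2) hl (hgc.pow 2) (fun x hx => ?_)
    rw [abs_pow]
    have h1 : |g x| ≤ Mk + |b| * D := by
      rw [hg x hx]
      have h1 := abs_sub (k x) (b * d x)
      have h2 := hMk x (hsub hx)
      rw [Real.norm_eq_abs] at h2
      rw [abs_mul] at h1
      have := mul_le_mul_of_nonneg_left (hD x hx) (abs_nonneg b)
      linarith
    gcongr
  have hu2 : IntervalIntegrable (fun x => u x ^ 2) volume 0 l :=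
    (hu.pow 2).intervalIntegrable_of_Icc hl.le
  have hL : IntervalIntegrable (fun x => 2 * u x * ut x) volume 0 l :=
    ((continuousOn_const.mul hu).mul hut).intervalIntegrable_of_Icc hl.le
  have hc : IntervalIntegrable (fun _ : ℝ => ρ) volume 0 l := intervalIntegrable_const
  have hmono := intervalIntegral.integral_mono_on_of_le_Ioo hl.le hL
    ((((hi1.const_mul 2).add (hu2.const_mul K)).add (hgi.const_mul 4)).add hc)
    (fun x hx => by
      have h1 := hs x hx
      have h2 := sq_nonneg (u x - (ut x - a ^ 2 * e x - b * d x - c * u x))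
      have h3 := mul_le_mul_of_nonneg_right hK (sq_nonneg (u x))
      nlinarith)
  have e1 : ∫ x in (0:ℝ)..l, 2 * (u x * (a ^ 2 * e x + b * d x)) =
     2 * ∫ x in (0:ℝ)..l, (u x * (a ^ 2 * e x + b * d x)) := by simp
  rw [intervalIntegral.integral_add (((hi1.const_mul 2).add (hu2.const_mul K)).add (hgi.const_mul 4)) hc,
    intervalIntegral.integral_add ((hi1.const_mul 2).add (hu2.const_mul K)) (hgi.const_mul 4),
    intervalIntegral.integral_add (hi1.const_mul 2) (hu2.const_mul K), e1] at hmono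
  simp only [intervalIntegral.integral_const_mul, intervalIntegral.integral_const, smul_eq_mul,
    sub_zero] at hmono
  linarith

lemma aux_bdry {l T : ℝ} (hl : 0 < l) {v w : ℝ → ℝ → ℝ}
    (hv : ContinuousOn (fun p : ℝ × ℝ => v p.1 p.2) (Icc 0 l ×ˢ Icc 0 T))
    (hw : ContinuousOn (fun p : ℝ × ℝ => w p.1 p.2) (Icc 0 l ×ˢ Icc 0 T))
    (hd : ∀ x ∈ Ioo 0 l, ∀ t ∈ Ioo 0 T, HasDerivAt (fun s => v x s) (w x t) t) :
    ∀ x ∈ Icc 0 l, ∀ t ∈ Ioo 0 T, HasDerivAt (fun s => v x s) (w x t) t := by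
  intro x hx t ht
  have hne : (𝓝[Ioo 0 l] x).NeBot := by
    rw [← mem_closure_iff_nhdsWithin_neBot, closure_Ioo hl.ne]; exact hx
  refine hasDerivAt_of_tendstoUniformlyOn (l := 𝓝[Ioo 0 l] x) (f := fun y s => v y s)
    (f' := fun y s => w y s) (g := fun s => v x s) (g' := fun s => w x s) isOpen_Ioo ?_ ?_ ?_ ht
  · have huc := (isCompact_Icc.prod isCompact_Icc).uniformContinuousOn_of_continuous hw
    rw [Metric.uniformContinuousOn_iff] at huc
    rw [Metric.tendstoUniformlyOn_iff]
    intro ε hε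
    obtain ⟨δ, hδ, h⟩ := huc ε hε
    have hb : ∀ᶠ y in 𝓝[Ioo 0 l] x, dist x y < δ := by
      apply mem_nhdsWithin_of_mem_nhds
      filter_upwards [Metric.ball_mem_nhds x hδ] with y hy
      rw [dist_comm]; exact hy
    filter_upwards [hb, self_mem_nhdsWithin] with y hy hy' s hs
    refine h (x, s) ⟨hx, Ioo_subset_Icc_self hs⟩ (y, s)
      ⟨Ioo_subset_Icc_self hy', Ioo_subset_Icc_self hs⟩ ?_
    simpa [Prod.dist_eq, hδ] using hy
  · filter_upwards [self_mem_nhdsWithin] with y hy s hs using hd y hy s hs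
  · intro s hs
    have h1 : ContinuousWithinAt (fun y => v y s) (Icc 0 l) x :=
      (hv (x, s) ⟨hx, Ioo_subset_Icc_self hs⟩).comp (f := fun y => (y, s))
        (by fun_prop) (fun y hy => ⟨hy, Ioo_subset_Icc_self hs⟩)
    exact h1.mono Ioo_subset_Icc_self

lemma aux_slx {l T : ℝ} {v : ℝ → ℝ → ℝ}
    (hv : ContinuousOn (fun p : ℝ × ℝ => v p.1 p.2) (Icc 0 l ×ˢ Icc 0 T)) {t : ℝ}
    (ht : t ∈ Icc 0 T) : ContinuousOn (fun x => v x t) (Icc 0 l) :=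
  hv.comp (f := fun y => (y, t)) (by fun_prop) (fun y hy => ⟨hy, ht⟩)

lemma aux_slt {l T : ℝ} {v : ℝ → ℝ → ℝ}
    (hv : ContinuousOn (fun p : ℝ × ℝ => v p.1 p.2) (Icc 0 l ×ˢ Icc 0 T)) {x : ℝ}
    (hx : x ∈ Icc 0 l) : ContinuousOn (fun t => v x t) (Icc 0 T) :=
  hv.comp (f := fun y => (x, y)) (by fun_prop) (fun y hy => ⟨hx, hy⟩)

lemma aux_energy_cont {l T : ℝ} (hl : 0 < l) {v : ℝ → ℝ → ℝ}
    (hv : ContinuousOn (fun p : ℝ × ℝ => v p.1 p.2) (Icc 0 l ×ˢ Icc 0 T)) :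
    ContinuousOn (fun t => ∫ x in (0:ℝ)..l, v x t ^ 2) (Icc 0 T) := by
  obtain ⟨M, hM⟩ := (isCompact_Icc.prod isCompact_Icc).exists_bound_of_continuousOn (hv.pow 2)
  intro t ht
  refine intervalIntegral.continuousWithinAt_of_dominated_interval (bound := fun _ => M) ?_ ?_
    intervalIntegrable_const ?_
  · filter_upwards [self_mem_nhdsWithin] with s hs
    exact (((aux_slx hv hs).pow 2).mono
      (by rw [uIoc_of_le hl.le]; exact Ioc_subset_Icc_self)).aestronglyMeasurable measurableSet_uIoc
  · filter_upwards [self_mem_nhdsWithin] with s hs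
    refine Eventually.of_forall fun x hx => ?_
    rw [uIoc_of_le hl.le] at hx
    exact hM (x, s) ⟨Ioc_subset_Icc_self hx, hs⟩
  · refine Eventually.of_forall fun x hx => ?_
    rw [uIoc_of_le hl.le] at hx
    exact ((aux_slt hv (Ioc_subset_Icc_self hx)).pow 2) t ht

lemma aux_energy_deriv {l T : ℝ} (hl : 0 < l) {v w : ℝ → ℝ → ℝ}
    (hv : ContinuousOn (fun p : ℝ × ℝ => v p.1 p.2) (Icc 0 l ×ˢ Icc 0 T))
    (hw : ContinuousOn (fun p : ℝ × ℝ => w p.1 p.2) (Icc 0 l ×ˢ Icc 0 T))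
    (hd : ∀ x ∈ Icc 0 l, ∀ t ∈ Ioo 0 T, HasDerivAt (fun s => v x s) (w x t) t)
    {t : ℝ} (ht : t ∈ Ioo 0 T) :
    HasDerivAt (fun t => ∫ x in (0:ℝ)..l, v x t ^ 2) (∫ x in (0:ℝ)..l, 2 * v x t * w x t) t := by
  have hF : ContinuousOn (fun p : ℝ × ℝ => 2 * v p.1 p.2 * w p.1 p.2) (Icc 0 l ×ˢ Icc 0 T) :=
    (continuousOn_const.mul hv).mul hw
  obtain ⟨M, hM⟩ := (isCompact_Icc.prod isCompact_Icc).exists_bound_of_continuousOn hF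
  have hsub : uIoc 0 l ⊆ Icc 0 l := by rw [uIoc_of_le hl.le]; exact Ioc_subset_Icc_self
  have hnt : Ioo 0 T ∈ 𝓝 t := isOpen_Ioo.mem_nhds ht
  refine (intervalIntegral.hasDerivAt_integral_of_dominated_loc_of_deriv_le (𝕜 := ℝ)
    (F := fun t x => v x t ^ 2) (F' := fun t x => 2 * v x t * w x t) (bound := fun _ => M)
    (s := Ioo 0 T) hnt ?_ ?_ ?_ ?_ intervalIntegrable_const ?_).2
  · filter_upwards [hnt] with s hs
    exact (((aux_slx hv (Ioo_subset_Icc_self hs)).pow 2).mono hsub).aestronglyMeasurable measurableSet_uIoc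
  · exact ((aux_slx hv (Ioo_subset_Icc_self ht)).pow 2).intervalIntegrable_of_Icc hl.le
  · exact ((aux_slx (v := fun x t => 2 * v x t * w x t) hF (Ioo_subset_Icc_self ht)).mono hsub).aestronglyMeasurable measurableSet_uIoc
  · exact Eventually.of_forall fun x hx s hs => hM (x, s) ⟨hsub hx, Ioo_subset_Icc_self hs⟩
  · refine Eventually.of_forall fun x hx s hs => ?_
    exact aux_sq (hd x (hsub hx) s hs)

lemma aux_trace {T : ℝ} (hT : 0 < T) {p q : ℝ → ℝ} (hp : ContinuousOn p (Icc 0 T))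
    (hd : ∀ t ∈ Ioo 0 T, HasDerivAt p (q t) t)
    (hi : IntervalIntegrable (fun t => p t ^ 2 + q t ^ 2) volume 0 T) :
    p 0 ^ 2 ≤ (1 + T) / T * ∫ t in (0:ℝ)..T, (p t ^ 2 + q t ^ 2) := by
  have := intervalIntegral.sub_le_integral_of_hasDeriv_right_of_le (a := 0) (b := T)
      (g := fun t => (t - T) * p t ^ 2)
      (g' := fun t => 1 * p t ^ 2 + (t - T) * (2 * p t * q t))
      (φ := fun t => (1 + T) * (p t ^ 2 + q t ^ 2)) hT.le
      ((by fun_prop : ContinuousOn (fun t : ℝ => t - T) (Icc 0 T)).mul (hp.pow 2))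
      (fun x hx => by
        have h2 := aux_sq (hd x hx)
        have h3 := (((hasDerivAt_id x).sub_const T).mul h2).hasDerivWithinAt (s := Ioi x)
        exact h3)
      ((intervalIntegrable_iff_integrableOn_Icc_of_le hT.le).1 (hi.const_mul _))
      (fun x hx => by
        have h0 : 0 ≤ T - x := by linarith [hx.2]
        have h1 := mul_nonneg h0 (sq_nonneg (p x + q x))
        have h2 := mul_nonneg hx.1.le (add_nonneg (sq_nonneg (p x)) (sq_nonneg (q x)))
        nlinarith [sq_nonneg (q x)])
  rw [intervalIntegral.integral_const_mul] at this
  rw [div_mul_eq_mul_div, le_div_iff₀ hT]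
  simp at this
  linarith

lemma aux_convex {s p q : ℝ} (h0 : 0 ≤ s) (h1 : s ≤ 1) :
    ((1 - s) * p + s * q) ^ 2 ≤ p ^ 2 + q ^ 2 := by
  have h2 : 0 ≤ s * (1 - s) := mul_nonneg h0 (by linarith)
  nlinarith [mul_nonneg h2 (sq_nonneg (p - q)), mul_nonneg h0 (sq_nonneg p),
    mul_nonneg (sub_nonneg.2 h1) (sq_nonneg q)]

lemma aux_four (p q r s : ℝ) : (p - q + r + s) ^ 2 ≤ 4 * (p ^ 2 + q ^ 2 + r ^ 2 + s ^ 2) := by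
  nlinarith [sq_nonneg (p + q), sq_nonneg (p - r), sq_nonneg (p - s), sq_nonneg (q + r),
    sq_nonneg (q + s), sq_nonneg (r - s)]

set_option maxHeartbeats 2000000 in
lemma aux_core {a b c l T : ℝ} (hl : 0 < l) (hT : 0 < T) {g v : ℝ → ℝ → ℝ} {θ₁ θ₂ ψ : ℝ → ℝ}
    (hv : IsClassicalSolution a b c l T g θ₁ θ₂ ψ v)
    (hG : IntervalIntegrable (fun t => ∫ x in (0:ℝ)..l, g x t ^ 2) volume 0 T)
    {q₁ r₁ q₂ r₂ : ℝ → ℝ} (hq₁ : q₁ = fun t => v 0 t) (hq₂ : q₂ = fun t => v l t)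
    (hr₁ : r₁ = fun t => deriv (fun s => v 0 s) t) (hr₂ : r₂ = fun t => deriv (fun s => v l s) t)
    (hn₁ : IntervalIntegrable (fun t => q₁ t ^ 2 + r₁ t ^ 2) volume 0 T)
    (hn₂ : IntervalIntegrable (fun t => q₂ t ^ 2 + r₂ t ^ 2) volume 0 T) :
    (∫ t in (0:ℝ)..T, ∫ x in (0:ℝ)..l, v x t ^ 2) ≤
      2 * T * exp (|2 * c + 1| * T) *
        ((2 * (∫ x in (0:ℝ)..l, v x 0 ^ 2) + 2 * l * ((1 + T) / T) *
          ((∫ t in (0:ℝ)..T, (q₁ t ^ 2 + r₁ t ^ 2)) + ∫ t in (0:ℝ)..T, (q₂ t ^ 2 + r₂ t ^ 2)))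
        + (4 * (∫ t in (0:ℝ)..T, ∫ x in (0:ℝ)..l, g x t ^ 2)
          + l * (4 * (1 + 2 * b ^ 2 / l ^ 2 + c ^ 2)) *
          ((∫ t in (0:ℝ)..T, (q₁ t ^ 2 + r₁ t ^ 2)) + ∫ t in (0:ℝ)..T, (q₂ t ^ 2 + r₂ t ^ 2))))
      + 2 * l * ((∫ t in (0:ℝ)..T, (q₁ t ^ 2 + r₁ t ^ 2))
          + ∫ t in (0:ℝ)..T, (q₂ t ^ 2 + r₂ t ^ 2)) := by
  obtain ⟨hvc, hvt, hvxx, hdiff, hpde, -, -⟩ := hv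
  set K := |2 * c + 1| with hKdef
  have hK0 : 0 ≤ K := abs_nonneg _
  set C₁ := 4 * (1 + 2 * b ^ 2 / l ^ 2 + c ^ 2) with hC₁
  have hC₁0 : 0 ≤ C₁ := by positivity
  have h0 : (0:ℝ) ∈ Icc 0 l := ⟨le_rfl, hl.le⟩
  have hll : l ∈ Icc 0 l := ⟨hl.le, le_rfl⟩
  have hsT : Ioo 0 T ⊆ Icc 0 T := Ioo_subset_Icc_self
  have hD := aux_bdry (v := v) (w := fun x t => deriv (fun s => v x s) t) hl hvc hvt
    (fun x hx t ht => (hdiff x hx t ht).1.hasDerivAt)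
  have hcq₁ : ContinuousOn q₁ (Icc 0 T) := hq₁ ▸ aux_slt hvc h0
  have hcq₂ : ContinuousOn q₂ (Icc 0 T) := hq₂ ▸ aux_slt hvc hll
  have hcr₁ : ContinuousOn r₁ (Icc 0 T) :=
    hr₁ ▸ aux_slt (v := fun x t => deriv (fun s => v x s) t) hvt h0
  have hcr₂ : ContinuousOn r₂ (Icc 0 T) :=
    hr₂ ▸ aux_slt (v := fun x t => deriv (fun s => v x s) t) hvt hll
  have hdq₁ : ∀ t ∈ Ioo 0 T, HasDerivAt q₁ (r₁ t) t := by
    intro t ht; rw [hq₁, hr₁]; exact hD 0 h0 t ht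
  have hdq₂ : ∀ t ∈ Ioo 0 T, HasDerivAt q₂ (r₂ t) t := by
    intro t ht; rw [hq₂, hr₂]; exact hD l hll t ht
  have hlift : ∀ {p q : ℝ → ℝ}, ContinuousOn p (Icc 0 T) → ContinuousOn q (Icc 0 T) →
      ContinuousOn (fun z : ℝ × ℝ => (1 - z.1 / l) * p z.2 + z.1 / l * q z.2)
        (Icc 0 l ×ˢ Icc 0 T) := by
    intro p q hp hq
    have h1 : ContinuousOn (fun z : ℝ × ℝ => p z.2) (Icc 0 l ×ˢ Icc 0 T) :=
      hp.comp (f := Prod.snd) (by fun_prop) (fun z hz => hz.2)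
    have h2 : ContinuousOn (fun z : ℝ × ℝ => q z.2) (Icc 0 l ×ˢ Icc 0 T) :=
      hq.comp (f := Prod.snd) (by fun_prop) (fun z hz => hz.2)
    have h3 : ContinuousOn (fun z : ℝ × ℝ => z.1 / l) (Icc 0 l ×ˢ Icc 0 T) := by fun_prop
    exact ((continuousOn_const.sub h3).mul h1).add (h3.mul h2)
  set W : ℝ → ℝ → ℝ := fun x t => v x t - ((1 - x / l) * q₁ t + x / l * q₂ t) with hW
  set Wt : ℝ → ℝ → ℝ := fun x t =>
    deriv (fun s => v x s) t - ((1 - x / l) * r₁ t + x / l * r₂ t) with hWt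
  have hWc : ContinuousOn (fun z : ℝ × ℝ => W z.1 z.2) (Icc 0 l ×ˢ Icc 0 T) :=
    hvc.sub (hlift hcq₁ hcq₂)
  have hWtc : ContinuousOn (fun z : ℝ × ℝ => Wt z.1 z.2) (Icc 0 l ×ˢ Icc 0 T) :=
    hvt.sub (hlift hcr₁ hcr₂)
  have hWd : ∀ x ∈ Icc 0 l, ∀ t ∈ Ioo 0 T, HasDerivAt (fun s => W x s) (Wt x t) t := by
    intro x hx t ht
    exact (hD x hx t ht).sub
      (((hdq₁ t ht).const_mul (1 - x / l)).add ((hdq₂ t ht).const_mul (x / l)))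
  have hfrac : ∀ x ∈ Icc 0 l, 0 ≤ x / l ∧ x / l ≤ 1 := fun x hx =>
    ⟨div_nonneg hx.1 hl.le, (div_le_one hl).2 hx.2⟩
  set E : ℝ → ℝ := fun t => ∫ x in (0:ℝ)..l, W x t ^ 2 with hE
  set G : ℝ → ℝ := fun t => ∫ x in (0:ℝ)..l, g x t ^ 2 with hGdef
  set R : ℝ → ℝ := fun t => (q₁ t ^ 2 + r₁ t ^ 2) + (q₂ t ^ 2 + r₂ t ^ 2) with hR
  have hRi : IntervalIntegrable R volume 0 T := hn₁.add hn₂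
  have hRint : ∫ t in (0:ℝ)..T, R t = (∫ t in (0:ℝ)..T, (q₁ t ^ 2 + r₁ t ^ 2))
          + ∫ t in (0:ℝ)..T, (q₂ t ^ 2 + r₂ t ^ 2) := intervalIntegral.integral_add hn₁ hn₂
  have hR0 : ∀ t, 0 ≤ R t := fun t => by simp only [hR]; positivity
  have hG0 : ∀ t, 0 ≤ G t := fun t =>
    intervalIntegral.integral_nonneg hl.le (fun x _ => sq_nonneg _)
  set H : ℝ → ℝ := fun t => 4 * G t + l * C₁ * R t with hH
  have hHi : IntervalIntegrable H volume 0 T := (hG.const_mul 4).add (hRi.const_mul (l * C₁))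
  have hHint : ∫ t in (0:ℝ)..T, H t = 4 * (∫ t in (0:ℝ)..T, G t) + l * C₁ * ∫ t in (0:ℝ)..T, R t := by
    simp only [hH]
    rw [intervalIntegral.integral_add (hG.const_mul 4) (hRi.const_mul (l * C₁)),
      intervalIntegral.integral_const_mul, intervalIntegral.integral_const_mul]
  have hH0 : ∀ t, 0 ≤ H t := fun t => by
    have := hR0 t; have := hG0 t; simp only [hH]; positivity
  have hslice : ∀ t ∈ Ioo 0 T, ∫ x in (0:ℝ)..l, 2 * W x t * Wt x t ≤ K * E t + H t := by
    intro t ht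
    have hk : ContinuousOn (fun x => deriv (fun s => v x s) t
        - a ^ 2 * deriv (fun y => deriv (fun z => v z t) y) x - c * v x t
        - b * ((q₂ t - q₁ t) / l)) (Icc 0 l) :=
      (((aux_slx (v := fun x t => deriv (fun s => v x s) t) hvt (hsT ht)).sub
        (continuousOn_const.mul
        (aux_slx (v := fun x t => deriv (fun y => deriv (fun z => v z t) y) x) hvxx (hsT ht)))).sub
        (continuousOn_const.mul (aux_slx hvc (hsT ht)))).sub continuousOn_const
    have := aux_slice (a := a) (b := b) (c := c) (K := K) (ρ := C₁ * R t) hl (le_abs_self _)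
      (u := fun x => W x t) (ut := fun x => Wt x t)
      (d := fun x => deriv (fun y => v y t) x - (q₂ t - q₁ t) / l)
      (e := fun x => deriv (fun y => deriv (fun z => v z t) y) x)
      (g := fun x => g x t) (k := _) (aux_slx hWc (hsT ht))
      (by simp [hW, hq₁]) (by simp [hW, hq₂, hl.ne'])
      (fun x hx => by
        have h1 := (hdiff x hx t ht).2.1.hasDerivAt
        have h2 : HasDerivAt (fun y : ℝ => (1 - y / l) * q₁ t + y / l * q₂ t)
            ((q₂ t - q₁ t) / l) x := by
          have h3 : HasDerivAt (fun y : ℝ => y / l) (1 / l) x := (hasDerivAt_id x).div_const l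
          have h4 := ((h3.const_sub 1).mul_const (q₁ t)).add (h3.mul_const (q₂ t))
          have h5 : (q₂ t - q₁ t) / l = -(1 / l) * q₁ t + 1 / l * q₂ t := by ring
          rw [h5]; exact h4
        exact h1.sub h2)
      (fun x hx => (hdiff x hx t ht).2.2.hasDerivAt.sub_const _)
      (aux_slx (v := fun x t => deriv (fun y => deriv (fun z => v z t) y) x) hvxx (hsT ht))
      (aux_slx hWtc (hsT ht)) hk
      (fun x hx => by have := hpde x hx t ht; simp only [this]; ring)
      (fun x hx => by
        have hp := hpde x hx t ht
        obtain ⟨hf0, hf1⟩ := hfrac x (Ioo_subset_Icc_self hx)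
        have e1 : Wt x t - a ^ 2 * deriv (fun y => deriv (fun z => v z t) y) x
            - b * (deriv (fun y => v y t) x - (q₂ t - q₁ t) / l) - c * W x t
            = g x t - ((1 - x / l) * r₁ t + x / l * r₂ t) + b * ((q₂ t - q₁ t) / l)
              + c * ((1 - x / l) * q₁ t + x / l * q₂ t) := by
          simp only [hW, hWt, hp]; ring
        simp only [e1]
        refine (aux_four _ _ _ _).trans ?_
        have b1 := aux_convex (p := r₁ t) (q := r₂ t) hf0 hf1
        have b2 := mul_le_mul_of_nonneg_left
          (aux_convex (p := q₁ t) (q := q₂ t) hf0 hf1) (sq_nonneg c)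
        have b3 : (b * ((q₂ t - q₁ t) / l)) ^ 2 ≤ 2 * b ^ 2 / l ^ 2 * (q₁ t ^ 2 + q₂ t ^ 2) := by
          have : (b * ((q₂ t - q₁ t) / l)) ^ 2 = b ^ 2 / l ^ 2 * (q₂ t - q₁ t) ^ 2 := by
            field_simp
          rw [this]
          have h1 : (q₂ t - q₁ t) ^ 2 ≤ 2 * (q₁ t ^ 2 + q₂ t ^ 2) := by
            nlinarith [sq_nonneg (q₁ t + q₂ t)]
          have h2 : 0 ≤ b ^ 2 / l ^ 2 := by positivity
          calc _ ≤ b ^ 2 / l ^ 2 * (2 * (q₁ t ^ 2 + q₂ t ^ 2)) := mul_le_mul_of_nonneg_left h1 h2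
            _ = _ := by ring
        have hB : 0 ≤ 2 * b ^ 2 / l ^ 2 := by positivity
        have b4 : C₁ * R t = 4 * ((q₁ t ^ 2 + q₂ t ^ 2) + (r₁ t ^ 2 + r₂ t ^ 2)
            + 2 * b ^ 2 / l ^ 2 * (q₁ t ^ 2 + q₂ t ^ 2) + 2 * b ^ 2 / l ^ 2 * (r₁ t ^ 2 + r₂ t ^ 2)
            + c ^ 2 * (q₁ t ^ 2 + q₂ t ^ 2) + c ^ 2 * (r₁ t ^ 2 + r₂ t ^ 2)) := by
          simp only [hC₁, hR]; ring
        rw [b4]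
        have b5 : 0 ≤ 2 * b ^ 2 / l ^ 2 * (r₁ t ^ 2 + r₂ t ^ 2) := by positivity
        have b6 : 0 ≤ c ^ 2 * (r₁ t ^ 2 + r₂ t ^ 2) := by positivity
        have b7 : 0 ≤ q₁ t ^ 2 + q₂ t ^ 2 := by positivity
        rw [mul_pow c]
        linarith)
    simp only [hH]
    calc _ ≤ _ := this
      _ = _ := by simp only [hE, hGdef]; ring
  have hEc : ContinuousOn E (Icc 0 T) := aux_energy_cont hl hWc
  have hE0 : ∀ t, 0 ≤ E t := fun t =>
    intervalIntegral.integral_nonneg hl.le (fun x _ => sq_nonneg _)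
  have hgron : ∀ t ∈ Icc 0 T, E t ≤ exp (K * T) * (E 0 + ∫ s in (0:ℝ)..T, H s) := by
    intro t ht
    have hsub : Icc 0 t ⊆ Icc 0 T := Icc_subset_Icc_right ht.2
    have h1 := intervalIntegral.sub_le_integral_of_hasDeriv_right_of_le (a := 0) (b := t)
      (g := fun s => exp (-K * s) * E s)
      (g' := fun s => exp (-K * s) * (-K * 1) * E s
        + exp (-K * s) * ∫ x in (0:ℝ)..l, 2 * W x s * Wt x s)
      (φ := H) ht.1
      ((by fun_prop : ContinuousOn (fun s : ℝ => exp (-K * s)) (Icc 0 t)).mul (hEc.mono hsub))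
      (fun s hs => by
        have hs' : s ∈ Ioo 0 T := ⟨hs.1, hs.2.trans_le ht.2⟩
        have h1 := (((hasDerivAt_id s).const_mul (-K)).exp)
        exact (h1.mul (aux_energy_deriv hl hWc hWtc hWd hs')).hasDerivWithinAt)
      (((intervalIntegrable_iff_integrableOn_Icc_of_le hT.le).1 hHi).mono_set hsub)
      (fun s hs => by
        have hs' : s ∈ Ioo 0 T := ⟨hs.1, hs.2.trans_le ht.2⟩
        have h1 := hslice s hs'
        have h2 : exp (-K * s) ≤ 1 := by
          rw [exp_le_one_iff]; nlinarith [mul_nonneg hK0 hs.1.le]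
        have h3 := mul_le_mul_of_nonneg_left h1 (exp_pos (-K * s)).le
        have h4 := mul_le_mul_of_nonneg_right h2 (hH0 s)
        nlinarith)
    have h2 : ∫ s in (0:ℝ)..t, H s ≤ ∫ s in (0:ℝ)..T, H s :=
      intervalIntegral.integral_mono_interval le_rfl ht.1 ht.2 (Eventually.of_forall hH0) hHi
    simp only [mul_zero, exp_zero, one_mul] at h1
    have h3 : exp (-K * t) * E t ≤ E 0 + ∫ s in (0:ℝ)..T, H s := by linarith
    have h4 : E t = exp (K * t) * (exp (-K * t) * E t) := by
      rw [← mul_assoc, ← exp_add]; simp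
    rw [h4]
    have h5 : exp (K * t) ≤ exp (K * T) := exp_le_exp.2 (mul_le_mul_of_nonneg_left ht.2 hK0)
    exact mul_le_mul h5 h3 (mul_nonneg (exp_pos _).le (hE0 t)) (exp_pos _).le
  have htr₁ := aux_trace hT hcq₁ hdq₁ hn₁
  have htr₂ := aux_trace hT hcq₂ hdq₂ hn₂
  have hsq : ∀ t ∈ Icc 0 T, IntervalIntegrable (fun x => v x t ^ 2) volume 0 l := fun t ht =>
    ((aux_slx hvc ht).pow 2).intervalIntegrable_of_Icc hl.le
  have hsqW : ∀ t ∈ Icc 0 T, IntervalIntegrable (fun x => W x t ^ 2) volume 0 l := fun t ht =>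
    ((aux_slx hWc ht).pow 2).intervalIntegrable_of_Icc hl.le
  have hz : (0:ℝ) ∈ Icc 0 T := ⟨le_rfl, hT.le⟩
  have hEinit : E 0 ≤ 2 * (∫ x in (0:ℝ)..l, v x 0 ^ 2) + 2 * l * (q₁ 0 ^ 2 + q₂ 0 ^ 2) := by
    have := intervalIntegral.integral_mono_on hl.le (hsqW 0 hz)
      (((hsq 0 hz).const_mul 2).add
        (intervalIntegrable_const (c := 2 * (q₁ 0 ^ 2 + q₂ 0 ^ 2))))
      (fun x hx => by
        obtain ⟨hf0, hf1⟩ := hfrac x hx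
        have := aux_convex (p := q₁ 0) (q := q₂ 0) hf0 hf1
        have h2 := sq_nonneg (v x 0 + ((1 - x / l) * q₁ 0 + x / l * q₂ 0))
        simp only [hW]
        nlinarith)
    rw [intervalIntegral.integral_add ((hsq 0 hz).const_mul 2) intervalIntegrable_const,
      intervalIntegral.integral_const_mul, intervalIntegral.integral_const] at this
    simp only [smul_eq_mul, sub_zero] at this
    linarith
  have hVle : ∀ t ∈ Icc 0 T, ∫ x in (0:ℝ)..l, v x t ^ 2 ≤ 2 * E t + 2 * l * R t := by
    intro t ht
    have := intervalIntegral.integral_mono_on hl.le (hsq t ht)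
      (((hsqW t ht).const_mul 2).add
        (intervalIntegrable_const (c := 2 * R t)))
      (fun x hx => by
        obtain ⟨hf0, hf1⟩ := hfrac x hx
        have := aux_convex (p := q₁ t) (q := q₂ t) hf0 hf1
        have h2 := sq_nonneg (v x t - 2 * ((1 - x / l) * q₁ t + x / l * q₂ t))
        simp only [hW, hR]
        nlinarith [sq_nonneg (r₁ t), sq_nonneg (r₂ t)])
    rw [intervalIntegral.integral_add ((hsqW t ht).const_mul 2) intervalIntegrable_const,
      intervalIntegral.integral_const_mul, intervalIntegral.integral_const] at this
    simp only [smul_eq_mul, sub_zero] at this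
    linarith
  have hfin := intervalIntegral.integral_mono_on hT.le
    ((aux_energy_cont hl hvc).intervalIntegrable_of_Icc hT.le)
    ((intervalIntegrable_const (c := 2 * (exp (K * T) * (E 0 + ∫ s in (0:ℝ)..T, H s)))).add
      (hRi.const_mul (2 * l)))
    (fun t ht => by
      have h1 := hVle t ht
      have h2 := hgron t ht
      have : (∫ x in (0:ℝ)..l, v x t ^ 2) ≤
        2 * (exp (K * T) * (E 0 + ∫ s in (0:ℝ)..T, H s)) + 2 * l * R t := by linarith
      exact this)
  rw [intervalIntegral.integral_add intervalIntegrable_const (hRi.const_mul (2 * l)),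
    intervalIntegral.integral_const_mul, intervalIntegral.integral_const, hHint, hRint] at hfin
  simp only [smul_eq_mul, sub_zero] at hfin
  refine hfin.trans ?_
  set N := (∫ t in (0:ℝ)..T, (q₁ t ^ 2 + r₁ t ^ 2)) + ∫ t in (0:ℝ)..T, (q₂ t ^ 2 + r₂ t ^ 2) with hN
  have hE00 : E 0 ≤ 2 * (∫ x in (0:ℝ)..l, v x 0 ^ 2) + 2 * l * ((1 + T) / T) * N := by
    have h1 : q₁ 0 ^ 2 + q₂ 0 ^ 2 ≤ (1 + T) / T * N := by rw [hN, mul_add]; linarith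
    have h2 := mul_le_mul_of_nonneg_left h1 (by positivity : 0 ≤ 2 * l)
    linarith
  have hpos : 0 ≤ 2 * T * exp (K * T) := by positivity
  have h3 := mul_le_mul_of_nonneg_left
    (add_le_add_left hE00 (4 * (∫ t in (0:ℝ)..T, G t) + l * C₁ * N)) hpos
  have h4 : ∫ x in (0:ℝ)..T, 2 * l * R x = 2 * l * N := by
    rw [intervalIntegral.integral_const_mul, hRint]
  rw [h4]
  refine le_trans (le_of_eq ?_) (add_le_add_left h3 (2 * l * N))
  ring

/-- Continuous dependence on the data: the `L²((0,T), L²((0,l)))`-norm of a classical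
solution `v` is bounded by a constant `C`, independent of the data, times the norm of
`(g, ψ, θ₁, θ₂)` in `L²((0,T), L²((0,l))) × L²((0,l)) × W^{1,2}((0,T)) × W^{1,2}((0,T))`. -/
theorem continuous_dependence_on_data
    (a b c l T : ℝ) (ha : a ≠ 0) (hl : 0 < l) (hT : 0 < T) :
    ∃ C > 0, ∀ (g : ℝ → ℝ → ℝ) (θ₁ θ₂ ψ : ℝ → ℝ) (v : ℝ → ℝ → ℝ),
      IsClassicalSolution a b c l T g θ₁ θ₂ ψ v →
      -- g ∈ L²((0,T), L²((0,l)))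
      IntegrableOn (fun p : ℝ × ℝ => (g p.1 p.2) ^ 2) (Set.Ioo 0 l ×ˢ Set.Ioo 0 T) →
      -- ψ ∈ L²((0,l))
      IntervalIntegrable (fun x => (ψ x) ^ 2) MeasureTheory.volume 0 l →
      -- θ₁, θ₂ ∈ W^{1,2}((0,T))
      IntervalIntegrable (fun t => (θ₁ t) ^ 2) MeasureTheory.volume 0 T →
      IntervalIntegrable (fun t => (deriv θ₁ t) ^ 2) MeasureTheory.volume 0 T →
      IntervalIntegrable (fun t => (θ₂ t) ^ 2) MeasureTheory.volume 0 T →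
      IntervalIntegrable (fun t => (deriv θ₂ t) ^ 2) MeasureTheory.volume 0 T →
      Real.sqrt (∫ t in (0:ℝ)..T, ∫ x in (0:ℝ)..l, (v x t) ^ 2) ≤
        C * Real.sqrt ((∫ t in (0:ℝ)..T, ∫ x in (0:ℝ)..l, (g x t) ^ 2)
          + (∫ x in (0:ℝ)..l, (ψ x) ^ 2)
          + (∫ t in (0:ℝ)..T, ((θ₁ t) ^ 2 + (deriv θ₁ t) ^ 2))
          + (∫ t in (0:ℝ)..T, ((θ₂ t) ^ 2 + (deriv θ₂ t) ^ 2))) := by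
  set A := 2 * T * exp (|2 * c + 1| * T) * (2 + 2 * l * ((1 + T) / T) + 4
    + l * (4 * (1 + 2 * b ^ 2 / l ^ 2 + c ^ 2))) + 2 * l with hA
  have hApos : 0 < A := by positivity
  refine ⟨Real.sqrt A, Real.sqrt_pos.2 hApos, ?_⟩
  intro g θ₁ θ₂ ψ v hv hg hψ h1 h1' h2 h2'
  obtain ⟨-, -, -, -, -, hbd, hin⟩ := id hv
  have hG : IntervalIntegrable (fun t => ∫ x in (0:ℝ)..l, g x t ^ 2) volume 0 T := by
    rw [intervalIntegrable_iff_integrableOn_Ioo_of_le hT.le]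
    have h : Integrable (fun p : ℝ × ℝ => g p.1 p.2 ^ 2)
        ((volume.restrict (Ioo 0 l)).prod (volume.restrict (Ioo 0 T))) := by
      rw [Measure.prod_restrict]; exact hg
    have h' := h.integral_prod_right
    simp only [intervalIntegral.integral_of_le hl.le, integral_Ioc_eq_integral_Ioo]
    exact h'
  have hae : ∀ (θ q : ℝ → ℝ), (∀ t ∈ Ioo 0 T, q t = θ t) →
      EqOn (fun t => θ t ^ 2 + deriv θ t ^ 2) (fun t => q t ^ 2 + deriv q t ^ 2) (Ioo 0 T) := by
    intro θ q h t ht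
    have : θ =ᶠ[𝓝 t] q := by
      filter_upwards [isOpen_Ioo.mem_nhds ht] with s hs using (h s hs).symm
    simp only [this.deriv_eq, h t ht]
  have hI : ∀ (f k : ℝ → ℝ) (b : ℝ), 0 < b → EqOn f k (Ioo 0 b) →
      ∫ t in (0:ℝ)..b, f t = ∫ t in (0:ℝ)..b, k t := by
    intro f k b hb h
    rw [intervalIntegral.integral_of_le hb.le, intervalIntegral.integral_of_le hb.le,
      integral_Ioc_eq_integral_Ioo, integral_Ioc_eq_integral_Ioo]
    exact setIntegral_congr_fun measurableSet_Ioo h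
  have hII : ∀ (f k : ℝ → ℝ), EqOn f k (Ioo 0 T) → IntervalIntegrable f volume 0 T →
      IntervalIntegrable k volume 0 T := by
    intro f k h hf
    rw [intervalIntegrable_iff_integrableOn_Ioo_of_le hT.le] at hf ⊢
    exact hf.congr_fun h measurableSet_Ioo
  have k1 := hae θ₁ (fun t => v 0 t) (fun t ht => (hbd t ht).1)
  have k2 := hae θ₂ (fun t => v l t) (fun t ht => (hbd t ht).2)
  have hcore := aux_core hl hT hv hG rfl rfl rfl rfl (hII _ _ k1 (h1.add h1'))
    (hII _ _ k2 (h2.add h2'))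
  rw [← hI _ _ T hT k1, ← hI _ _ T hT k2,
    hI (fun x => v x 0 ^ 2) (fun x => ψ x ^ 2) l hl
      (fun x hx => by simp only [hin x hx])] at hcore
  have p1 : 0 ≤ ∫ t in (0:ℝ)..T, (θ₁ t ^ 2 + deriv θ₁ t ^ 2) :=
    intervalIntegral.integral_nonneg hT.le (fun x _ => by positivity)
  have p2 : 0 ≤ ∫ t in (0:ℝ)..T, (θ₂ t ^ 2 + deriv θ₂ t ^ 2) :=
    intervalIntegral.integral_nonneg hT.le (fun x _ => by positivity)
  have p3 : 0 ≤ ∫ x in (0:ℝ)..l, ψ x ^ 2 :=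
    intervalIntegral.integral_nonneg hl.le (fun x _ => by positivity)
  have p4 : 0 ≤ ∫ t in (0:ℝ)..T, ∫ x in (0:ℝ)..l, g x t ^ 2 :=
    intervalIntegral.integral_nonneg hT.le
      (fun t _ => intervalIntegral.integral_nonneg hl.le (fun x _ => by positivity))
  rw [← Real.sqrt_mul hApos.le]
  refine Real.sqrt_le_sqrt (hcore.trans ?_)
  generalize (∫ t in (0:ℝ)..T, (θ₁ t ^ 2 + deriv θ₁ t ^ 2)) = n₁ at *
  generalize (∫ t in (0:ℝ)..T, (θ₂ t ^ 2 + deriv θ₂ t ^ 2)) = n₂ at *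
  generalize (∫ x in (0:ℝ)..l, ψ x ^ 2) = P at *
  generalize (∫ t in (0:ℝ)..T, ∫ x in (0:ℝ)..l, g x t ^ 2) = Q at *
  have c1 : 0 ≤ 2 * l * ((1 + T) / T) := by positivity
  have c2 : 0 ≤ l * (4 * (1 + 2 * b ^ 2 / l ^ 2 + c ^ 2)) := by positivity
  have c3 : 0 ≤ 2 * T * exp (|2 * c + 1| * T) := by positivity
  rw [hA]
  generalize 2 * l * ((1 + T) / T) = α at *
  generalize l * (4 * (1 + 2 * b ^ 2 / l ^ 2 + c ^ 2)) = β at *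
  generalize 2 * T * exp (|2 * c + 1| * T) = γ at *
  have d1 : (2 * P + α * (n₁ + n₂)) + (4 * Q + β * (n₁ + n₂)) ≤
      (2 + α + 4 + β) * (Q + P + n₁ + n₂) := by
    have e1 := mul_nonneg c1 (add_nonneg p3 p4)
    have e2 := mul_nonneg c2 (add_nonneg p3 p4)
    nlinarith
  have d2 := mul_le_mul_of_nonneg_left d1 c3
  have d3 : 2 * l * (n₁ + n₂) ≤ 2 * l * (Q + P + n₁ + n₂) :=
    mul_le_mul_of_nonneg_left (by linarith) (by positivity)
  calc _ ≤ γ * ((2 + α + 4 + β) * (Q + P + n₁ + n₂)) + 2 * l * (Q + P + n₁ + n₂) :=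
        add_le_add d2 d3
    _ = _ := by ring


end
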